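/- There do not exist real numbers A and t with A > 0 such that 3A + 2t³ + 7t² + 4t = 0 and 15A(t + 1) + 5t⁴ + 27t³ + 35t² + 8t = 0. -/

import Mathlib

/-- Subcase 2a contradiction in the exclusion of Case (VI): the system
`3A + 2t³ + 7t² + 4t = 0`, `15A(t+1) + 5t⁴ + 27t³ + 35t² + 8t = 0` has no
solution with `A > 0`. -/
theorem case_VI_subcase_2a_impossible :
    ¬ ∃ A t : ℝ, 0 < A ∧
      3 * A + 2 * t ^ 3 + 7 * t ^ 2 + 4 * t = 0 ∧
      15 * A * (t + 1) + 5 * t ^ 4 + 27 * t ^ 3 + 35 * t ^ 2 + 8 * t = 0 := by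
  rintro ⟨A, t, hA, h1, h2⟩
  have h : t * (5 * t ^ 3 + 18 * t ^ 2 + 20 * t + 12) = 0 := by
    linear_combination 5 * (t + 1) * h1 - h2
  rcases mul_eq_zero.mp h with h0 | hp
  · subst h0
    linarith
  · have ha : -(5 / 2) < t := by
      by_contra hc
      have hc' : 0 ≤ -(t + 5 / 2) := by linarith
      have hq : 0 ≤ 5 * t ^ 2 + 11 / 2 * t + 25 / 4 := by
        nlinarith [sq_nonneg (t + 11 / 20)]
      nlinarith [mul_nonneg hc' hq]
    have hb : t < -1 := by
      by_contra hc
      have hc' : 0 ≤ t + 1 := by linarith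
      have hs : 0 ≤ (t + 1) ^ 3 := pow_nonneg hc' 3
      nlinarith [sq_nonneg (t + 1 - 1 / 6)]
    have hq : 2 * t ^ 2 + 7 * t + 4 < 0 := by
      nlinarith [mul_pos (show 0 < t + 5 / 2 by linarith) (show 0 < -1 - t by linarith)]
    nlinarith [mul_pos_of_neg_of_neg (show t < 0 by linarith) hq]
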